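/- arXiv:2209.12273 — 2 statements merged into one kernel-verified Lean document; each statement's English description precedes it below -/
import Mathlib

section
/- Let s ≠ t be vertices and let F ⊆ E satisfy the capacity condition for (s,t), with 𝒞 its family of violated cuts. Then there exist three subfamilies 𝒞₁, 𝒞₂, 𝒞₃ ⊆ 𝒞 with 𝒞 = 𝒞₁ ∪ 𝒞₂ ∪ 𝒞₃ such that each 𝒞_j is closed under intersections and unions of properly intersecting members: whenever A, B ∈ 𝒞_j properly intersect, both A ∩ B ∈ 𝒞_j and A ∪ B ∈ 𝒞_j. (Since every member of 𝒞 contains s, each nonempty 𝒞_j is therefore a ring family with a unique inclusion-minimal member.) -/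
open scoped BigOperators

/-- An edge `e` crosses the vertex set `A` if exactly one of its endpoints lies in `A`. -/
def crosses {V E : Type*} (ends : E → Sym2 V) (A : Set V) (e : E) : Prop :=
  ∃ u v : V, ends e = s(u, v) ∧ u ∈ A ∧ v ∉ A

/-- `cut ends F A` is `δ_F(A)`: the set of edges of `F` with exactly one endpoint in `A`. -/
def cut {V E : Type*} (ends : E → Sym2 V) (F : Set E) (A : Set V) : Set E :=
  {e | e ∈ F ∧ crosses ends A e}

/-- Two vertex sets properly intersect. -/
def properlyIntersect {V : Type*} (A B : Set V) : Prop :=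
  (A ∩ B).Nonempty ∧ (A \ B).Nonempty ∧ (B \ A).Nonempty

/-- `F` satisfies the capacity condition for the pair `(s,t)`. -/
def capCond {V E : Type*} (ends : E → Sym2 V) (𝒮 𝒰 : Set E) (s t : V) (F : Set E) : Prop :=
  ∀ A : Set V, s ∈ A → t ∉ A →
    4 ≤ 2 * (cut ends (F ∩ 𝒮) A).ncard + (cut ends (F ∩ 𝒰) A).ncard

/-- The family of violated cuts of `F` for the `(2,2)`-Flex-ST augmentation. -/
def violatedST {V E : Type*} (ends : E → Sym2 V) (𝒮 𝒰 : Set E) (s t : V) (F : Set E) :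
    Set (Set V) :=
  {A | s ∈ A ∧ t ∉ A ∧ (cut ends (F ∩ 𝒮) A).ncard = 1 ∧ (cut ends (F ∩ 𝒰) A).ncard = 2}

/-- A family of vertex sets is closed under intersections and unions of properly
intersecting members. -/
def closedUnderCross {V : Type*} (𝒞 : Set (Set V)) : Prop :=
  ∀ A B, A ∈ 𝒞 → B ∈ 𝒞 → properlyIntersect A B → A ∩ B ∈ 𝒞 ∧ A ∪ B ∈ 𝒞

open scoped symmDiff

section Cuts

variable {V E : Type*} {ends : E → Sym2 V}

lemma crosses_iff {A : Set V} {e : E} {u v : V} (h : ends e = s(u, v)) :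
    crosses ends A e ↔ ¬(u ∈ A ↔ v ∈ A) := by
  constructor
  · rintro ⟨x, y, hxy, hx, hy⟩
    rw [h, Sym2.eq_iff] at hxy
    rcases hxy with ⟨rfl, rfl⟩ | ⟨rfl, rfl⟩ <;> tauto
  · intro hne
    by_cases hu : u ∈ A
    · exact ⟨u, v, h, hu, by tauto⟩
    · exact ⟨v, u, by rw [h, Sym2.eq_swap], by tauto, hu⟩

lemma cut_inter_subset (G : Set E) (A B : Set V) :
    cut ends G (A ∩ B) ⊆ cut ends G A ∪ cut ends G B := by
  rintro e ⟨he, u, v, h, hu, hv⟩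
  simp only [cut, Set.mem_union, Set.mem_ofPred_eq, crosses_iff h, Set.mem_inter_iff] at *
  tauto

lemma cut_union_subset (G : Set E) (A B : Set V) :
    cut ends G (A ∪ B) ⊆ cut ends G A ∪ cut ends G B := by
  rintro e ⟨he, u, v, h, hu, hv⟩
  simp only [cut, Set.mem_union, Set.mem_ofPred_eq, crosses_iff h] at *
  tauto

lemma cut_inter_inter_cut_union_subset (G : Set E) (A B : Set V) :
    cut ends G (A ∩ B) ∩ cut ends G (A ∪ B) ⊆ cut ends G A ∩ cut ends G B := by
  rintro e ⟨⟨he, u, v, h, hu, hv⟩, ⟨-, hc⟩⟩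
  rw [crosses_iff h] at hc
  simp only [cut, Set.mem_union, Set.mem_ofPred_eq, crosses_iff h, Set.mem_inter_iff] at *
  tauto

/-- The cut function is submodular. -/
lemma ncard_cut_inter_add_ncard_cut_union_le [Finite E] (G : Set E) (A B : Set V) :
    (cut ends G (A ∩ B)).ncard + (cut ends G (A ∪ B)).ncard ≤
      (cut ends G A).ncard + (cut ends G B).ncard := by
  rw [← Set.ncard_union_add_ncard_inter (cut ends G (A ∩ B)),
    ← Set.ncard_union_add_ncard_inter (cut ends G A)]
  exact Nat.add_le_add
    (Set.ncard_le_ncard (Set.union_subset (cut_inter_subset G A B) (cut_union_subset G A B)))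
    (Set.ncard_le_ncard (cut_inter_inter_cut_union_subset G A B))

lemma ncard_cut_eq_add [Finite E] {𝒮 𝒰 : Set E} (hpart : 𝒮 ∪ 𝒰 = Set.univ)
    (hdisj : Disjoint 𝒮 𝒰) (F : Set E) (A : Set V) :
    (cut ends F A).ncard = (cut ends (F ∩ 𝒮) A).ncard + (cut ends (F ∩ 𝒰) A).ncard := by
  rw [← Set.ncard_union_eq]
  · congr 1
    ext e
    have he : e ∈ 𝒮 ∪ 𝒰 := hpart ▸ Set.mem_univ e
    simp only [cut, Set.mem_union, Set.mem_ofPred_eq, Set.mem_inter_iff] at *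
    tauto
  · exact Set.disjoint_left.2 fun e h₁ h₂ => Set.disjoint_left.1 hdisj h₁.1.2 h₂.1.2

lemma odd_ncard_symmDiff_singleton_iff [Finite E] (X : Set E) (e : E) :
    Odd (X ∆ {e}).ncard ↔ ¬ Odd X.ncard := by
  by_cases he : e ∈ X
  · have h : X ∆ {e} = X \ {e} := by
      ext x; simp only [Set.mem_symmDiff, Set.mem_sdiff, Set.mem_singleton_iff]; grind
    rw [h, ← Set.ncard_sdiff_singleton_add_one he, Nat.odd_add_one, not_not]
  · have h : X ∆ {e} = insert e X := by
      ext x; simp only [Set.mem_symmDiff, Set.mem_insert_iff, Set.mem_singleton_iff]; grind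
    rw [h, Set.ncard_insert_of_notMem he, Nat.odd_add_one]

/-- A walk in `F` from `s` to `x`, reduced modulo two, is an edge set `P ⊆ F` that meets a cut
around `s` in an odd number of edges exactly when the cut separates `s` from `x`. -/
lemma exists_odd_ncard_cut_iff_of_reflTransGen [Finite E] {F : Set E} {s x : V}
    (h : Relation.ReflTransGen (fun u v => ∃ e ∈ F, ends e = s(u, v)) s x) :
    ∃ P ⊆ F, ∀ M : Set V, s ∈ M → (Odd (cut ends P M).ncard ↔ x ∉ M) := by
  induction h with
  | refl => exact ⟨∅, Set.empty_subset F, fun M hs => by simp [cut, hs]⟩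
  | @tail y z _ hyz ih =>
    obtain ⟨P, hPF, hP⟩ := ih
    obtain ⟨e, heF, he⟩ := hyz
    refine ⟨P ∆ {e}, ?_, fun M hs => ?_⟩
    · rintro a (ha | ha)
      · exact hPF ha.1
      · exact ha.1 ▸ heF
    · have hM := hP M hs
      by_cases hc : crosses ends M e
      · have h : cut ends (P ∆ {e}) M = cut ends P M ∆ {e} := by
          ext a
          simp only [cut, Set.mem_symmDiff, Set.mem_ofPred_eq, Set.mem_singleton_iff]
          grind
        rw [h, odd_ncard_symmDiff_singleton_iff, hM]
        rw [crosses_iff he] at hc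
        tauto
      · have h : cut ends (P ∆ {e}) M = cut ends P M := by
          ext a
          simp only [cut, Set.mem_symmDiff, Set.mem_ofPred_eq, Set.mem_singleton_iff]
          grind
        rw [h, hM]
        rw [crosses_iff he] at hc
        tauto

/-- If every cut separating `s` from `t` meets `F`, then some `P ⊆ F` meets all of them in an odd
number of edges. -/
lemma exists_odd_ncard_cut [Finite E] {F : Set E} {s t : V}
    (h : ∀ M : Set V, s ∈ M → t ∉ M → (cut ends F M).Nonempty) :
    ∃ P ⊆ F, ∀ M : Set V, s ∈ M → t ∉ M → Odd (cut ends P M).ncard := by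
  have hreach : Relation.ReflTransGen (fun u v => ∃ e ∈ F, ends e = s(u, v)) s t := by
    by_contra ht
    obtain ⟨e, heF, u, v, he, hu, hv⟩ := h
      {x | Relation.ReflTransGen (fun u v => ∃ e ∈ F, ends e = s(u, v)) s x} .refl ht
    exact hv (hu.tail ⟨e, heF, he⟩)
  obtain ⟨P, hPF, hP⟩ := exists_odd_ncard_cut_iff_of_reflTransGen hreach
  exact ⟨P, hPF, fun M hs ht => (hP M hs).2 ht⟩

/-- If no cut of `F` that separates `s` from `t` and has exactly two edges lies within `Q`, then
the violated cuts whose safe edge lies in `Q` are closed under uncrossing. -/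
lemma closedUnderCross_violatedST_sep [Finite E] {𝒮 𝒰 : Set E} {s t : V} {F Q : Set E}
    (hpart : 𝒮 ∪ 𝒰 = Set.univ) (hdisj : Disjoint 𝒮 𝒰) (hF : capCond ends 𝒮 𝒰 s t F)
    (hQ : ∀ M : Set V, s ∈ M → t ∉ M → (cut ends F M).ncard = 2 → ¬ cut ends F M ⊆ Q) :
    closedUnderCross {A ∈ violatedST ends 𝒮 𝒰 s t F | cut ends (F ∩ 𝒮) A ⊆ Q} := by
  rintro A B ⟨⟨hsA, htA, hSA, hUA⟩, hAQ⟩ ⟨⟨hsB, htB, hSB, hUB⟩, hBQ⟩ -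
  have hs : s ∈ A ∩ B := ⟨hsA, hsB⟩
  have ht : t ∉ A ∩ B := fun h => htA h.1
  have hs' : s ∈ A ∪ B := Or.inl hsA
  have ht' : t ∉ A ∪ B := fun h => h.elim htA htB
  have hiQ := (cut_inter_subset (ends := ends) (F ∩ 𝒮) A B).trans (Set.union_subset hAQ hBQ)
  have huQ := (cut_union_subset (ends := ends) (F ∩ 𝒮) A B).trans (Set.union_subset hAQ hBQ)
  have hcapi := hF _ hs ht
  have hcapu := hF _ hs' ht'
  have hsubS := ncard_cut_inter_add_ncard_cut_union_le (ends := ends) (F ∩ 𝒮) A B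
  have hsubU := ncard_cut_inter_add_ncard_cut_union_le (ends := ends) (F ∩ 𝒰) A B
  have hne : ∀ M : Set V, s ∈ M → t ∉ M → cut ends (F ∩ 𝒮) M ⊆ Q →
      (cut ends (F ∩ 𝒰) M).ncard = 0 → (cut ends (F ∩ 𝒮) M).ncard ≠ 2 := by
    intro M hsM htM hMQ hU hS
    have hcard := ncard_cut_eq_add (ends := ends) hpart hdisj F M
    refine hQ M hsM htM (by omega) ?_
    rwa [← Set.eq_of_subset_of_ncard_le (s := cut ends (F ∩ 𝒮) M) (t := cut ends F M)
      (fun e he => ⟨he.1.1, he.2⟩) (by omega)]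
  have hnei := hne _ hs ht hiQ
  have hneu := hne _ hs' ht' huQ
  exact ⟨⟨⟨hs, ht, by omega, by omega⟩, hiQ⟩, ⟨⟨hs', ht', by omega, by omega⟩, huQ⟩⟩

end Cuts

theorem stmt6 {V E : Type*} [Fintype V] [Fintype E]
    (ends : E → Sym2 V) (𝒮 𝒰 : Set E)
    (hpart : 𝒮 ∪ 𝒰 = Set.univ) (hdisj : Disjoint 𝒮 𝒰)
    (s t : V) (hst : s ≠ t)
    (F : Set E) (hF : capCond ends 𝒮 𝒰 s t F) :
    ∃ 𝒞₁ 𝒞₂ 𝒞₃ : Set (Set V),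
      𝒞₁ ⊆ violatedST ends 𝒮 𝒰 s t F ∧ 𝒞₂ ⊆ violatedST ends 𝒮 𝒰 s t F ∧
      𝒞₃ ⊆ violatedST ends 𝒮 𝒰 s t F ∧
      violatedST ends 𝒮 𝒰 s t F = 𝒞₁ ∪ 𝒞₂ ∪ 𝒞₃ ∧
      closedUnderCross 𝒞₁ ∧ closedUnderCross 𝒞₂ ∧ closedUnderCross 𝒞₃ := by
  obtain ⟨P, hPF, hP⟩ := exists_odd_ncard_cut (ends := ends) (F := F) (s := s) (t := t) (by
    intro M hs ht
    have h₁ := hF M hs ht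
    have h₂ := ncard_cut_eq_add (ends := ends) hpart hdisj F M
    exact Set.nonempty_of_ncard_ne_zero (by omega))
  refine ⟨{A ∈ violatedST ends 𝒮 𝒰 s t F | cut ends (F ∩ 𝒮) A ⊆ P},
    {A ∈ violatedST ends 𝒮 𝒰 s t F | cut ends (F ∩ 𝒮) A ⊆ Pᶜ}, ∅,
    Set.sep_subset _ _, Set.sep_subset _ _, Set.empty_subset _, ?_,
    closedUnderCross_violatedST_sep hpart hdisj hF ?_,
    closedUnderCross_violatedST_sep hpart hdisj hF ?_, fun A B hA => hA.elim⟩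
  · ext A
    simp only [Set.union_empty, Set.mem_union, Set.mem_ofPred_eq, ← and_or_left]
    refine ⟨fun hA => ⟨hA, ?_⟩, fun hA => hA.1⟩
    obtain ⟨e, he⟩ := Set.ncard_eq_one.1 hA.2.2.1
    simpa [he] using em (e ∈ P)
  · intro M hs ht hcard hsub
    have h : cut ends P M = cut ends F M :=
      Set.Subset.antisymm (fun e he => ⟨hPF he.1, he.2⟩) fun e he => ⟨hsub he, he.2⟩
    have hodd := hP M hs ht
    rw [h, hcard] at hodd
    exact absurd hodd (by decide)
  · intro M hs ht _ hsub
    have h : cut ends P M = ∅ :=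
      Set.eq_empty_of_forall_notMem fun e he => hsub ⟨hPF he.1, he.2⟩ he.1
    have hodd := hP M hs ht
    simp [h] at hodd
end

section
/- There exist a multigraph (a finite vertex type V, finite edge type E, endpoint map ends : E → Sym2 V) with a partition of E into safe edges 𝒮 and unsafe edges 𝒰, vertices s ≠ t, a set F ⊆ E satisfying the capacity condition for (s,t), and sets A, B in the family 𝒞 of violated cuts of F that properly intersect, such that it is not the case that both A ∩ B and A ∪ B belong to 𝒞, nor that both A \ B and B \ A belong to 𝒞. That is, the family of violated cuts for the (2,2)-Flex-ST augmentation problem is in general not uncrossable. -/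
open scoped BigOperators

/-- Over finite types, `|δ_F(A)|` is the size of a filtered finset. -/
theorem ncard_cut_coe {V E : Type*} [Fintype V] [DecidableEq V] (ends : E → Sym2 V)
    (F : Finset E) (A : Finset V) :
    (cut ends (F : Set E) (A : Set V)).ncard =
      (F.filter fun e => ∃ u v : V, ends e = s(u, v) ∧ u ∈ A ∧ v ∉ A).card := by
  rw [← Set.ncard_coe_finset]
  congr 1
  ext e
  simp [cut, crosses]

/-- The multigraph on `s = 0`, `a = 1`, `b = 2`, `t = 3` with single edges `sa`, `sb`
(edges `0`, `1`) and doubled edges `at`, `bt` (edges `2`, `3` and `4`, `5`). -/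
def diamondEnds : Fin 6 → Sym2 (Fin 4) :=
  ![s(0, 1), s(0, 2), s(1, 3), s(1, 3), s(2, 3), s(2, 3)]

/-- The edges of the diamond at `s`, taken to be the safe ones. -/
def diamondSafe : Finset (Fin 6) := {0, 1}

/-- The edges of the diamond at `t`, taken to be the unsafe ones. -/
def diamondUnsafe : Finset (Fin 6) := {2, 3, 4, 5}

theorem capCond_diamond : capCond diamondEnds diamondSafe diamondUnsafe 0 3 Set.univ := by
  intro A
  lift A to Finset (Fin 4) using A.toFinite
  simp only [Set.univ_inter, ncard_cut_coe, Finset.mem_coe]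
  revert A
  decide

theorem coe_mem_violatedST_diamond (A : Finset (Fin 4)) :
    (A : Set (Fin 4)) ∈ violatedST diamondEnds diamondSafe diamondUnsafe 0 3 Set.univ ↔
      A = {0, 1} ∨ A = {0, 2} := by
  simp only [violatedST, Set.mem_ofPred_eq, Set.univ_inter, ncard_cut_coe, Finset.mem_coe]
  revert A
  decide

theorem stmt15 :
    ∃ (V E : Type) (_ : Fintype V) (_ : Fintype E) (ends : E → Sym2 V)
      (𝒮 𝒰 : Set E) (s t : V) (F : Set E) (A B : Set V),
      𝒮 ∪ 𝒰 = Set.univ ∧ Disjoint 𝒮 𝒰 ∧ s ≠ t ∧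
      capCond ends 𝒮 𝒰 s t F ∧
      A ∈ violatedST ends 𝒮 𝒰 s t F ∧ B ∈ violatedST ends 𝒮 𝒰 s t F ∧
      properlyIntersect A B ∧
      ¬(A ∩ B ∈ violatedST ends 𝒮 𝒰 s t F ∧ A ∪ B ∈ violatedST ends 𝒮 𝒰 s t F) ∧
      ¬(A \ B ∈ violatedST ends 𝒮 𝒰 s t F ∧ B \ A ∈ violatedST ends 𝒮 𝒰 s t F) := by
  refine ⟨Fin 4, Fin 6, inferInstance, inferInstance, diamondEnds, diamondSafe, diamondUnsafe,
    0, 3, Set.univ, ({0, 1} : Finset (Fin 4)), ({0, 2} : Finset (Fin 4)), ?_, ?_, by decide,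
    capCond_diamond, ?_, ?_, ?_, ?_, ?_⟩
  · rw [← Finset.coe_union, ← Finset.coe_univ, Finset.coe_inj]
    decide
  · rw [Finset.disjoint_coe]
    decide
  · simp only [coe_mem_violatedST_diamond, true_or]
  · simp only [coe_mem_violatedST_diamond, or_true]
  · simp only [properlyIntersect, ← Finset.coe_inter, ← Finset.coe_sdiff, Finset.coe_nonempty]
    decide
  · simp only [← Finset.coe_inter, ← Finset.coe_union, coe_mem_violatedST_diamond]
    decide
  · simp only [← Finset.coe_sdiff, coe_mem_violatedST_diamond]
    decide
end
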